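/- Let k be a measurable kernel generating the semimetric ρ of negative type on a topological space Z. Then (Z,ρ) has strong negative type (i.e., for all Borel probability measures P≠Q with ∫k(z,z)dP<∞ and ∫k(z,z)dQ<∞ one has ∫ρ d([P−Q]×[P−Q]) < 0) if and only if for all such P≠Q, γ_k²(P,Q) = ∫∫ k d([P−Q]×[P−Q]) > 0 (i.e., k is characteristic to this class of measures). -/

import Mathlib

open MeasureTheory

/-- A semimetric on a nonempty set `Z`: nonnegative, vanishing exactly on the
diagonal, and symmetric. -/
def IsSemimetric {Z : Type*} (ρ : Z → Z → ℝ) : Prop :=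
  (∀ z z', 0 ≤ ρ z z') ∧ (∀ z z', ρ z z' = 0 ↔ z = z') ∧ (∀ z z', ρ z z' = ρ z' z)

/-- A function `ρ` has negative type if for all `n ≥ 2`, points `z_1,…,z_n` and
reals `α_1,…,α_n` with `Σ α_i = 0`, one has `Σ_i Σ_j α_i α_j ρ(z_i,z_j) ≤ 0`. -/
def HasNegativeType {Z : Type*} (ρ : Z → Z → ℝ) : Prop :=
  ∀ (n : ℕ), 2 ≤ n → ∀ (z : Fin n → Z) (α : Fin n → ℝ),
    (∑ i, α i) = 0 → ∑ i, ∑ j, α i * α j * ρ (z i) (z j) ≤ 0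

/-- A kernel on `Z`: a symmetric positive definite function `k : Z × Z → ℝ`. -/
def IsPosDefKernel {Z : Type*} (k : Z → Z → ℝ) : Prop :=
  (∀ z z', k z z' = k z' z) ∧
  ∀ (n : ℕ) (z : Fin n → Z) (α : Fin n → ℝ),
    0 ≤ ∑ i, ∑ j, α i * α j * k (z i) (z j)

lemma IsPosDefKernel.abs_le {Z : Type*} {k : Z → Z → ℝ} (hker : IsPosDefKernel k) (z w : Z) :
    |k z w| ≤ (k z z + k w w) / 2 := by
  have hsub := hker.2 2 ![z, w] ![1, -1]
  have hadd := hker.2 2 ![z, w] ![1, 1]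
  have hsymm := hker.1 w z
  simp [Fin.sum_univ_two] at hsub hadd
  rw [_root_.abs_le]
  constructor <;> linarith

lemma IsPosDefKernel.integrable_prod {Z : Type*} [MeasurableSpace Z] {k : Z → Z → ℝ}
    (hker : IsPosDefKernel k) (hmeas : Measurable fun p : Z × Z => k p.1 p.2)
    {μ ν : Measure Z} [IsFiniteMeasure μ] [IsFiniteMeasure ν]
    (hμ : Integrable (fun z => k z z) μ) (hν : Integrable (fun z => k z z) ν) :
    Integrable (fun p : Z × Z => k p.1 p.2) (μ.prod ν) :=
  (((hμ.comp_fst ν).add (hν.comp_snd μ)).div_const 2).mono' hmeas.aestronglyMeasurable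
    (Filter.Eventually.of_forall fun p => hker.abs_le p.1 p.2)

lemma IsPosDefKernel.integrable_right {Z : Type*} [MeasurableSpace Z] {k : Z → Z → ℝ}
    (hker : IsPosDefKernel k) (hmeas : Measurable fun p : Z × Z => k p.1 p.2)
    {ν : Measure Z} [IsFiniteMeasure ν] (hν : Integrable (fun z => k z z) ν) (z : Z) :
    Integrable (k z) ν :=
  (((integrable_const (k z z)).add hν).div_const 2).mono'
    (hmeas.comp measurable_prodMk_left).aestronglyMeasurable
    (Filter.Eventually.of_forall fun w => hker.abs_le z w)

/-- The energy of a pair of probability measures for the semimetric generated by `k`. -/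
lemma IsPosDefKernel.integral_integral_generated {Z : Type*} [MeasurableSpace Z]
    {k ρ : Z → Z → ℝ} (hker : IsPosDefKernel k)
    (hmeas : Measurable fun p : Z × Z => k p.1 p.2)
    (hgen : ∀ z z', ρ z z' = k z z + k z' z' - 2 * k z z')
    {μ ν : Measure Z} [IsProbabilityMeasure μ] [IsProbabilityMeasure ν]
    (hμ : Integrable (fun z => k z z) μ) (hν : Integrable (fun z => k z z) ν) :
    ∫ z, ∫ w, ρ z w ∂ν ∂μ =
      (∫ z, k z z ∂μ) + (∫ w, k w w ∂ν) - 2 * ∫ z, ∫ w, k z w ∂ν ∂μ := by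
  have inner (z : Z) :
      ∫ w, ρ z w ∂ν = k z z + (∫ w, k w w ∂ν) - 2 * ∫ w, k z w ∂ν := by
    simp_rw [hgen]
    have hsum : Integrable (fun w => k z z + k w w) ν := (integrable_const _).add hν
    rw [integral_sub hsum
        ((hker.integrable_right hmeas hν z).const_mul 2),
      integral_add (integrable_const _) hν, integral_const_mul]
    simp
  have hprod : Integrable (fun z => ∫ w, k z w ∂ν) μ :=
    (hker.integrable_prod hmeas hμ hν).integral_prod_left
  simp_rw [inner]
  have hsum : Integrable (fun z => k z z + ∫ w, k w w ∂ν) μ := hμ.add (integrable_const _)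
  rw [integral_sub hsum (hprod.const_mul 2),
    integral_add hμ (integrable_const _), integral_const_mul]
  simp

/-- a semimetric `ρ` of negative type generated by a measurable
kernel `k` has strong negative type (the energy bilinear form is strictly
negative on differences of distinct probability measures in `M_k^1`) iff `k`
is characteristic to `M_+^1(Z) ∩ M_k^1(Z)` (the squared MMD is strictly
positive for distinct such measures). -/
theorem strong_negative_type_iff_characteristic
    {Z : Type*} [Nonempty Z] [TopologicalSpace Z] [MeasurableSpace Z] [BorelSpace Z]
    (ρ : Z → Z → ℝ) (hsemi : IsSemimetric ρ) (hneg : HasNegativeType ρ)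
    (k : Z → Z → ℝ) (hker : IsPosDefKernel k)
    (hmeas : Measurable fun p : Z × Z => k p.1 p.2)
    (hgen : ∀ z z', ρ z z' = k z z + k z' z' - 2 * k z z') :
    (∀ P Q : Measure Z, IsProbabilityMeasure P → IsProbabilityMeasure Q →
        Integrable (fun z => k z z) P → Integrable (fun z => k z z) Q → P ≠ Q →
        (∫ z, (∫ w, ρ z w ∂P) ∂P) - (∫ z, (∫ w, ρ z w ∂Q) ∂P)
          - (∫ z, (∫ w, ρ z w ∂P) ∂Q) + (∫ z, (∫ w, ρ z w ∂Q) ∂Q) < 0) ↔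
    (∀ P Q : Measure Z, IsProbabilityMeasure P → IsProbabilityMeasure Q →
        Integrable (fun z => k z z) P → Integrable (fun z => k z z) Q → P ≠ Q →
        0 < (∫ z, (∫ w, k z w ∂P) ∂P) - (∫ z, (∫ w, k z w ∂Q) ∂P)
          - (∫ z, (∫ w, k z w ∂P) ∂Q) + (∫ z, (∫ w, k z w ∂Q) ∂Q)) := by
  refine forall₂_congr fun P Q => forall₅_congr fun _ _ hP hQ _ => ?_
  rw [hker.integral_integral_generated hmeas hgen hP hP,
    hker.integral_integral_generated hmeas hgen hP hQ,
    hker.integral_integral_generated hmeas hgen hQ hP,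
    hker.integral_integral_generated hmeas hgen hQ hQ]
  constructor <;> intro h <;> linarith
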